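/- Let s ≤ ⌊n/3⌋ + 1. Among generally admissible paths of size (n,s) (unconstrained paths from (0,0) to (n+2−2s, n+2) with first and last step right), no path crosses the line x = n+2−2s strictly before crossing the line x = 0. -/

import Mathlib

open Finset
open scoped Classical
noncomputable section

/-- Position (x-coordinate) after `t` steps of the path `p`, where `true` encodes a
right step `(x,y) ↦ (x+1,y+1)` and `false` a left step `(x,y) ↦ (x-1,y+1)`. -/
def pathPos {m : ℕ} (p : Fin m → Bool) (t : ℕ) : ℤ :=
  ∑ j : Fin m, if (j : ℕ) < t then (if p j then (1 : ℤ) else -1) else 0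

/-- Generally admissible paths of size `(n,s)`: `n+2` diagonal steps starting at `(0,0)`,
the 0-th and the last step going right, with exactly `s` left steps
(hence ending at `(n+2-2s, n+2)`). -/
def admissible (n s : ℕ) : Finset (Fin (n + 2) → Bool) :=
  Finset.univ.filter (fun p =>
    (∀ j : Fin (n + 2), (j : ℕ) = 0 → p j = true) ∧
    (∀ j : Fin (n + 2), (j : ℕ) = n + 1 → p j = true) ∧
    (Finset.univ.filter (fun j => p j = false)).card = s)

/-- The path crosses the line `x = 0`, i.e. reaches x-coordinate `-1` at some time. -/
def crossesLeft {m : ℕ} (p : Fin m → Bool) : Prop :=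
  ∃ t ∈ Finset.range (m + 1), pathPos p t = -1

/-- A path of size `(n,s)` crosses the line `x = n+2-2s`,
i.e. reaches x-coordinate `n+3-2s` at some time. -/
def crossesRight (n s : ℕ) (p : Fin (n + 2) → Bool) : Prop :=
  ∃ t ∈ Finset.range (n + 3), pathPos p t = (n : ℤ) + 3 - 2 * s

/-- `L n s`: the number of generally admissible paths of size `(n,s)`
crossing the line `x = 0`. -/
def L (n s : ℕ) : ℕ := ((admissible n s).filter (fun p => crossesLeft p)).card

/-- Constrained lattice paths: `n+2` diagonal steps from `(0,0)` to `(n+2-2s, n+2)`,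
staying inside the strip `0 ≤ x ≤ n+2-2s`.  (`n` is allowed to be a negative integer,
with the convention that there are `max (n+2) 0` steps.) -/
def aPaths (n : ℤ) (s : ℕ) : Finset (Fin (n + 2).toNat → Bool) :=
  Finset.univ.filter (fun p =>
    pathPos p (n + 2).toNat = n + 2 - 2 * s ∧
    ∀ t ∈ Finset.range ((n + 2).toNat + 1),
      0 ≤ pathPos p t ∧ pathPos p t ≤ n + 2 - 2 * s)

/-- `a n s`: the number of lattice paths from `(0,0)` to `(n+2-2s, n+2)` with steps
`(x,y) ↦ (x±1, y+1)` staying inside the strip `0 ≤ x ≤ n+2-2s`. -/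
def a (n : ℤ) (s : ℕ) : ℕ := (aPaths n s).card

/-- Binomial coefficient `C(n,k)` with integer lower index, zero when `k < 0`. -/
def binom (n : ℕ) (k : ℤ) : ℕ := if k < 0 then 0 else n.choose k.toNat

/-- `b W H`: the number of lattice paths from `(0,0)` to `(W,H)` with steps
`(x,y) ↦ (x±1,y+1)` staying in the strip `0 ≤ x ≤ W`, whose first and last steps go
right, and whose intermediate steps come in consecutive same-direction pairs
`(1,2), (3,4), …, (H-3,H-2)`. -/
def bPaths (W H : ℕ) : Finset (Fin H → Bool) :=
  Finset.univ.filter (fun p =>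
    (∀ j : Fin H, (j : ℕ) = 0 → p j = true) ∧
    (∀ j : Fin H, (j : ℕ) = H - 1 → p j = true) ∧
    (∀ j1 j2 : Fin H, (j1 : ℕ) % 2 = 1 → (j2 : ℕ) = (j1 : ℕ) + 1 →
      (j1 : ℕ) + 1 ≤ H - 2 → p j1 = p j2) ∧
    pathPos p H = (W : ℤ) ∧
    ∀ t ∈ Finset.range (H + 1), 0 ≤ pathPos p t ∧ pathPos p t ≤ (W : ℤ))

def b (W H : ℕ) : ℕ := (bPaths W H).card

theorem pathPos_zero {m : ℕ} (p : Fin m → Bool) : pathPos p 0 = 0 := by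
  simp [pathPos]

theorem abs_pathPos_succ_sub_le {m : ℕ} (p : Fin m → Bool) (t : ℕ) :
    |pathPos p (t + 1) - pathPos p t| ≤ 1 := by
  have key : pathPos p (t + 1) - pathPos p t =
      ∑ j : Fin m, if (j : ℕ) = t then (if p j then (1 : ℤ) else -1) else 0 := by
    unfold pathPos
    rw [← Finset.sum_sub_distrib]
    refine Finset.sum_congr rfl fun j _ => ?_
    split_ifs <;> omega
  rw [key]
  by_cases ht : t < m
  · rw [Finset.sum_eq_single_of_mem (⟨t, ht⟩ : Fin m) (Finset.mem_univ _)
      fun j _ hj => if_neg fun h => hj (Fin.ext h)]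
    split_ifs <;> simp
  · rw [Finset.sum_eq_zero fun j _ => if_neg (by have := j.isLt; omega)]
    simp

theorem abs_pathPos_sub_le {m : ℕ} (p : Fin m → Bool) {t u : ℕ} (htu : t ≤ u) :
    |pathPos p u - pathPos p t| ≤ (u : ℤ) - t := by
  induction u, htu using Nat.le_induction with
  | base => simp
  | succ u _ ih =>
    have hstep := abs_pathPos_succ_sub_le p u
    rw [abs_le] at *
    push_cast
    constructor <;> linarith [hstep.1, hstep.2, ih.1, ih.2]

theorem pathPos_length {m : ℕ} (p : Fin m → Bool) :
    pathPos p m = m - 2 * ((Finset.univ.filter fun j => p j = false).card : ℤ) := by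
  have hterm : ∀ j : Fin m, (if (j : ℕ) < m then (if p j then (1 : ℤ) else -1) else 0) =
      1 - 2 * (if p j = false then 1 else 0) := by
    intro j
    cases hp : p j <;> simp [j.isLt]
  unfold pathPos
  rw [Finset.sum_congr rfl fun j _ => hterm j, Finset.sum_sub_distrib, ← Finset.mul_sum,
    Finset.sum_boole]
  simp

/-- for `s ≤ ⌊n/3⌋ + 1`, no generally admissible path of size `(n,s)`
crosses the line `x = n+2-2s` strictly before crossing the line `x = 0`; i.e. there is
no path that reaches `-1` at some time but first reaches `n+3-2s` at a time before
which (inclusively) it has never been at `-1`. -/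
theorem stmt9 (n s : ℕ) (h : s ≤ n / 3 + 1) :
    ¬ ∃ p ∈ admissible n s,
      (∃ t ∈ Finset.range (n + 3), pathPos p t = -1) ∧
      (∃ t1 ∈ Finset.range (n + 3), pathPos p t1 = (n : ℤ) + 3 - 2 * s ∧
        ∀ u ∈ Finset.range (t1 + 1), pathPos p u ≠ -1) := by
  rintro ⟨p, hp, ⟨t, ht, hpt⟩, t₁, ht₁, hpt₁, hbefore⟩
  rw [Finset.mem_range] at ht ht₁
  have hlt : t₁ < t := by
    by_contra! hle
    exact hbefore t (Finset.mem_range.2 (by omega)) hpt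
  have hend := pathPos_length p
  rw [(Finset.mem_filter.1 hp).2.2.2] at hend
  have h_up := (abs_le.1 (abs_pathPos_sub_le p (Nat.zero_le t₁))).2
  have h_down := (abs_le.1 (abs_pathPos_sub_le p hlt.le)).1
  have h_back := (abs_le.1 (abs_pathPos_sub_le p (show t ≤ n + 2 by omega))).2
  rw [pathPos_zero] at h_up
  push_cast at *
  omega
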